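/- arXiv:math/0512583 — 2 statements merged into one kernel-verified Lean document; each statement's English description precedes it below -/
import Mathlib

section
/- Let b∈(ℂ^×)⁴, aᵢ=bᵢ+bᵢ⁻¹, θ=θ(b), and {i,j,k}={1,2,3}. Then the involution σᵢ exchanges the two lines E_k = {x∈ℂ³ : xⱼ = bⱼb₄+(bⱼb₄)⁻¹ and x_k+(bⱼb₄)xᵢ = aᵢbⱼ+a_kb₄} and G_l = {x∈ℂ³ : xⱼ = bⱼb₄+(bⱼb₄)⁻¹ and x_k+(bⱼb₄)⁻¹xᵢ = aᵢbⱼ⁻¹+a_kb₄⁻¹}: a point x lies on E_k if and only if σᵢ(x) lies on G_l, and x lies on G_l if and only if σᵢ(x) lies on E_k. -/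
open Finset

noncomputable section

/-- The cubic polynomial `f(x,θ) = x₁x₂x₃ + x₁²+x₂²+x₃² − θ₁x₁ − θ₂x₂ − θ₃x₃ + θ₄`
(indices shifted to start at 0). -/
def fcubic (θ : Fin 4 → ℂ) (x : Fin 3 → ℂ) : ℂ :=
  x 0 * x 1 * x 2 + x 0 ^ 2 + x 1 ^ 2 + x 2 ^ 2
    - θ 0 * x 0 - θ 1 * x 1 - θ 2 * x 2 + θ 3

/-- The involution `σᵢ : (σᵢ x)ᵢ = θᵢ − xᵢ − xⱼx_k`, other coordinates unchanged. -/
def sigmaMap (θ : Fin 4 → ℂ) (i : Fin 3) (x : Fin 3 → ℂ) : Fin 3 → ℂ :=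
  Function.update x i (θ i.castSucc - x i - ∏ l ∈ Finset.univ.erase i, x l)

/-- The Coxeter transformation `c = σ₁ ∘ σ₂ ∘ σ₃` (σ₃ applied first). -/
def coxeter (θ : Fin 4 → ℂ) : (Fin 3 → ℂ) → (Fin 3 → ℂ) :=
  sigmaMap θ 0 ∘ sigmaMap θ 1 ∘ sigmaMap θ 2

/-- `aᵢ = bᵢ + bᵢ⁻¹`. -/
def aOf (b : Fin 4 → ℂ) (l : Fin 4) : ℂ := b l + (b l)⁻¹

/-- `θ(b)`: `θᵢ = aᵢa₄ + aⱼa_k` for `{i,j,k} = {1,2,3}` and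
`θ₄ = a₁a₂a₃a₄ + a₁²+a₂²+a₃²+a₄² − 4`. -/
def thetaOf (b : Fin 4 → ℂ) : Fin 4 → ℂ :=
  ![aOf b 0 * aOf b 3 + aOf b 1 * aOf b 2,
    aOf b 1 * aOf b 3 + aOf b 0 * aOf b 2,
    aOf b 2 * aOf b 3 + aOf b 0 * aOf b 1,
    aOf b 0 * aOf b 1 * aOf b 2 * aOf b 3
      + aOf b 0 ^ 2 + aOf b 1 ^ 2 + aOf b 2 ^ 2 + aOf b 3 ^ 2 - 4]

/-- The discriminant `Δ(b) = ∏ₗ(bₗ−bₗ⁻¹)² · ∏_{ε∈{±1}⁴}(b^ε − 1)`. -/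
def Delta (b : Fin 4 → ℂ) : ℂ :=
  (∏ l, (b l - (b l)⁻¹) ^ 2) *
    ∏ ε : Fin 4 → Bool, ((∏ l, if ε l then b l else (b l)⁻¹) - 1)

theorem thetaOf_castSucc (b : Fin 4 → ℂ) {i j k : Fin 3}
    (hij : i ≠ j) (hjk : j ≠ k) (hik : i ≠ k) :
    thetaOf b i.castSucc =
      aOf b i.castSucc * aOf b 3 + aOf b j.castSucc * aOf b k.castSucc := by
  fin_cases i <;> fin_cases j <;> fin_cases k <;> simp_all [thetaOf] <;> ring

theorem sigmaMap_self (θ : Fin 4 → ℂ) (x : Fin 3 → ℂ) {i j k : Fin 3}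
    (hij : i ≠ j) (hjk : j ≠ k) (hik : i ≠ k) :
    sigmaMap θ i x i = θ i.castSucc - x i - x j * x k := by
  have h : Finset.univ.erase i = {j, k} := by
    revert i j k
    decide
  simp [sigmaMap, h, Finset.prod_pair hjk]

theorem sigmaMap_of_ne (θ : Fin 4 → ℂ) (x : Fin 3 → ℂ) {i j : Fin 3} (hij : i ≠ j) :
    sigmaMap θ i x j = x j :=
  Function.update_of_ne hij.symm _ _

/-- On the plane `xⱼ = uv + (uv)⁻¹`, the involution `xᵢ ↦ θᵢ − xᵢ − xⱼx_k` exchanges the line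
`x_k + uvxᵢ = aᵢu + a_kv` with the line `x_k + (uv)⁻¹xᵢ = aᵢu⁻¹ + a_kv⁻¹`. -/
theorem line_iff_reflected_line {u v : ℂ} (hu : u ≠ 0) (hv : v ≠ 0) (ai ak xi xk : ℂ) :
    xk + (u * v) * xi = ai * u + ak * v ↔
      xk + (u * v)⁻¹ *
          (ai * (v + v⁻¹) + (u + u⁻¹) * ak - xi - (u * v + (u * v)⁻¹) * xk) =
        ai * u⁻¹ + ak * v⁻¹ := by
  have key : xk + (u * v)⁻¹ *
          (ai * (v + v⁻¹) + (u + u⁻¹) * ak - xi - (u * v + (u * v)⁻¹) * xk) -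
        (ai * u⁻¹ + ak * v⁻¹) =
      -((u * v)⁻¹ ^ 2) * (xk + (u * v) * xi - (ai * u + ak * v)) := by
    field_simp
    ring
  rw [← sub_eq_zero, ← sub_eq_zero (b := ai * u⁻¹ + ak * v⁻¹), key]
  simp [hu, hv]

/-- the involution `σᵢ` exchanges the lines
`E_k = {xⱼ = bⱼb₄+(bⱼb₄)⁻¹, x_k+(bⱼb₄)xᵢ = aᵢbⱼ+a_kb₄}` and
`G_l = {xⱼ = bⱼb₄+(bⱼb₄)⁻¹, x_k+(bⱼb₄)⁻¹xᵢ = aᵢbⱼ⁻¹+a_kb₄⁻¹}`. -/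
theorem sigma_exchanges_Ek_Gl (b : Fin 4 → ℂ) (hb : ∀ l, b l ≠ 0)
    (i j k : Fin 3) (hij : i ≠ j) (hjk : j ≠ k) (hik : i ≠ k) :
    let θ := thetaOf b
    let Ek : Set (Fin 3 → ℂ) :=
      {x | x j = b j.castSucc * b 3 + (b j.castSucc * b 3)⁻¹ ∧
        x k + (b j.castSucc * b 3) * x i
          = aOf b i.castSucc * b j.castSucc + aOf b k.castSucc * b 3}
    let Gl : Set (Fin 3 → ℂ) :=
      {x | x j = b j.castSucc * b 3 + (b j.castSucc * b 3)⁻¹ ∧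
        x k + (b j.castSucc * b 3)⁻¹ * x i
          = aOf b i.castSucc * (b j.castSucc)⁻¹ + aOf b k.castSucc * (b 3)⁻¹}
    ∀ x : Fin 3 → ℂ,
      (x ∈ Ek ↔ sigmaMap θ i x ∈ Gl) ∧ (x ∈ Gl ↔ sigmaMap θ i x ∈ Ek) := by
  intro θ Ek Gl x
  have hj := hb j.castSucc
  have h3 := hb 3
  simp only [Ek, Gl, θ, Set.mem_ofPred_eq, sigmaMap_self _ x hij hjk hik, sigmaMap_of_ne _ x hij,
    sigmaMap_of_ne _ x hik, thetaOf_castSucc b hij hjk hik]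
  refine ⟨and_congr_right fun hx => ?_, and_congr_right fun hx => ?_⟩
  · simpa only [hx, aOf] using line_iff_reflected_line hj h3
      (aOf b i.castSucc) (aOf b k.castSucc) (x i) (x k)
  · have h := line_iff_reflected_line (inv_ne_zero hj) (inv_ne_zero h3)
      (aOf b i.castSucc) (aOf b k.castSucc) (x i) (x k)
    simp only [← mul_inv, inv_inv] at h
    rw [h, hx]
    simp only [aOf, add_comm (b 3)⁻¹, add_comm (b j.castSucc)⁻¹,
      add_comm (b j.castSucc * b 3)⁻¹]
end
end

section
/- Regarded as a matrix over ℂ, the 7×7 matrix C has eigenvalues exactly 0, −1, 2+√5, and 2−√5, where −1 has algebraic multiplicity 4 and the other three eigenvalues are simple. Consequently the spectral radius of C equals 2+√5. -/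
noncomputable section

/-- Matrix of the Coxeter pullback `c*` on `H²(S̄(θ),ℤ)` in the basis `(E₀,…,E₆)`. -/
def CoxMat : Matrix (Fin 7) (Fin 7) ℤ :=
  !![12,  6,  6,  4,  4,  3,  3;
     -3, -2, -1, -1, -1, -1, -1;
     -3, -1, -2, -1, -1, -1, -1;
     -4, -2, -2, -2, -1, -1, -1;
     -4, -2, -2, -1, -2, -1, -1;
     -6, -3, -3, -2, -2, -2, -1;
     -6, -3, -3, -2, -2, -1, -2]

/-- The Coxeter matrix regarded as a complex matrix. -/
def CoxMatC : Matrix (Fin 7) (Fin 7) ℂ := CoxMat.map (Int.cast : ℤ → ℂ)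

open Polynomial in
theorem charpoly_coxMat :
    CoxMat.charpoly = X * (X + 1) ^ 4 * (X ^ 2 - 4 * X - 1) := by
  let U : Matrix (Fin 7) (Fin 3) ℤ :=
    !![-1, -1, -1; 1, 0, 0; 1, 0, 0; 0, 1, 0; 0, 1, 0; 0, 0, 1; 0, 0, 1]
  let V : Matrix (Fin 3) (Fin 7) ℤ :=
    !![-3, -1, -1, -1, -1, -1, -1; -4, -2, -2, -1, -1, -1, -1; -6, -3, -3, -2, -2, -1, -1]
  have hC : CoxMat = U * V - Matrix.scalar (Fin 7) 1 := by decide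
  have hVU : V * U = !![1, 1, 1; 0, 2, 2; 0, 2, 4] := by decide
  have h3 : (V * U).charpoly = (X - 1) * (X ^ 2 - 6 * X + 4) := by
    rw [hVU, Matrix.charpoly, Matrix.det_fin_three]
    simp
    ring
  rw [hC, Matrix.charpoly_sub_scalar, Matrix.charpoly_mul_comm_of_le U V (by simp), h3]
  simp
  ring

open Polynomial in
theorem charpoly_coxMatC :
    CoxMatC.charpoly = (X - C 0) * (X - C (-1)) ^ 4 * (X - C (2 + (Real.sqrt 5 : ℂ))) *
      (X - C (2 - (Real.sqrt 5 : ℂ))) := by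
  have h5 : (Real.sqrt 5 : ℂ) ^ 2 = 5 := by
    rw [← Complex.ofReal_pow, Real.sq_sqrt (by norm_num)]; norm_num
  have hC5 : (C (Real.sqrt 5 : ℂ)) ^ 2 = 5 := by rw [← C_pow, h5]; rfl
  have hmap : CoxMatC.charpoly = CoxMat.charpoly.map (Int.castRingHom ℂ) :=
    Matrix.charpoly_map CoxMat (Int.castRingHom ℂ)
  rw [hmap, charpoly_coxMat]
  have h2 : (C 2 : ℂ[X]) = 2 := rfl
  simp [h2]
  linear_combination (X * (X + 1) ^ 4) * hC5

theorem roots_charpoly_coxMatC :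
    CoxMatC.charpoly.roots = 0 ::ₘ (2 + (Real.sqrt 5 : ℂ)) ::ₘ (2 - (Real.sqrt 5 : ℂ)) ::ₘ
      Multiset.replicate 4 (-1) := by
  have h : CoxMatC.charpoly = ((0 ::ₘ (2 + (Real.sqrt 5 : ℂ)) ::ₘ (2 - (Real.sqrt 5 : ℂ)) ::ₘ
      Multiset.replicate 4 (-1)).map fun a => Polynomial.X - Polynomial.C a).prod := by
    rw [charpoly_coxMatC]
    simp only [Multiset.map_cons, Multiset.prod_cons, Multiset.map_replicate,
      Multiset.prod_replicate]
    ring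
  rw [h, Polynomial.roots_multiset_prod_X_sub_C]

/-- over `ℂ` the Coxeter matrix has eigenvalues exactly `0`, `−1`, `2+√5`,
`2−√5`, with `−1` of algebraic multiplicity `4` and the others simple; consequently its
spectral radius equals `2+√5`. -/
theorem coxeter_matrix_eigenvalues :
    spectrum ℂ CoxMatC =
      {0, -1, 2 + (Real.sqrt 5 : ℂ), 2 - (Real.sqrt 5 : ℂ)} ∧
    Polynomial.rootMultiplicity (-1) CoxMatC.charpoly = 4 ∧
    Polynomial.rootMultiplicity 0 CoxMatC.charpoly = 1 ∧
    Polynomial.rootMultiplicity (2 + (Real.sqrt 5 : ℂ)) CoxMatC.charpoly = 1 ∧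
    Polynomial.rootMultiplicity (2 - (Real.sqrt 5 : ℂ)) CoxMatC.charpoly = 1 ∧
    spectralRadius ℂ CoxMatC = ENNReal.ofReal (2 + Real.sqrt 5) := by
  have hs : (2 : ℝ) < Real.sqrt 5 := Real.lt_sqrt_of_sq_lt (by norm_num)
  have hs' : Real.sqrt 5 < 3 := (Real.sqrt_lt' (by norm_num)).2 (by norm_num)
  have ne_of_real {a b : ℝ} (h : a ≠ b) : (a : ℂ) ≠ b := fun e => h (Complex.ofReal_injective e)
  have h01 : (0 : ℂ) ≠ 2 + Real.sqrt 5 := mod_cast ne_of_real (by linarith : 0 < 2 + √5).ne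
  have h02 : (0 : ℂ) ≠ 2 - Real.sqrt 5 := mod_cast ne_of_real (by linarith : 2 - √5 < 0).ne'
  have h12 : (2 + Real.sqrt 5 : ℂ) ≠ 2 - Real.sqrt 5 :=
    mod_cast ne_of_real (by linarith : 2 - √5 < 2 + √5).ne'
  have h1n : (-1 : ℂ) ≠ 2 + Real.sqrt 5 := mod_cast ne_of_real (by linarith : -1 < 2 + √5).ne
  have h2n : (-1 : ℂ) ≠ 2 - Real.sqrt 5 := mod_cast ne_of_real (by linarith : -1 < 2 - √5).ne
  have hspec : spectrum ℂ CoxMatC =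
      {0, -1, 2 + (Real.sqrt 5 : ℂ), 2 - (Real.sqrt 5 : ℂ)} := by
    ext z
    rw [Matrix.mem_spectrum_iff_isRoot_charpoly,
      ← Polynomial.mem_roots (Matrix.charpoly_monic _).ne_zero, roots_charpoly_coxMatC]
    simp
    tauto
  refine ⟨hspec, ?_, ?_, ?_, ?_, ?_⟩
  iterate 4
    rw [← Polynomial.count_roots, roots_charpoly_coxMatC]
    simp [Multiset.count_cons, Multiset.count_replicate, h01, h02, h12, h1n, h2n, h01.symm,
      h02.symm, h12.symm, h1n.symm, h2n.symm]
  have hnorm (r : ℝ) : (‖(r : ℂ)‖₊ : ENNReal) = ENNReal.ofReal |r| := by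
    rw [← Real.norm_eq_abs, ← Complex.norm_real, ofReal_norm, enorm_eq_nnnorm]
  have n1 : (‖(2 + Real.sqrt 5 : ℂ)‖₊ : ENNReal) = ENNReal.ofReal (2 + √5) := by
    have := hnorm (2 + √5)
    rw [abs_of_pos (by linarith)] at this
    exact_mod_cast this
  have n2 : (‖(2 - Real.sqrt 5 : ℂ)‖₊ : ENNReal) ≤ ENNReal.ofReal (2 + √5) := by
    have := hnorm (2 - √5)
    push_cast at this
    rw [this]
    exact ENNReal.ofReal_le_ofReal (abs_le.2 ⟨by linarith, by linarith⟩)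
  have n3 : (1 : ENNReal) ≤ ENNReal.ofReal (2 + √5) :=
    ENNReal.one_le_ofReal.2 (by linarith)
  rw [spectralRadius, hspec]
  simp only [iSup_insert, iSup_singleton, n1]
  simp [n2, n3]
end
end
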